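/- Let α, β ∈ (0,1) and T ≥ 1. The T×T second-order Diagonal Correlated (DC2) kernel matrix K with entries K_{ij} = β^{max(i,j)}(1 − (1−β)α^{|i−j|+1}) − α²β^{max(i,j)+1} for i, j ∈ {1,…,T} is symmetric positive semidefinite. -/

import Mathlib

/-- A real kernel whose entries are the sums of the series `∑ k, w k * φ i k * φ j k` with
nonnegative weights `w` is positive semidefinite. -/
theorem Matrix.posSemidef_of_hasSum_mul {ι κ : Type*} [Fintype ι] {A : Matrix ι ι ℝ}
    {w : κ → ℝ} {φ : ι → κ → ℝ} (hw : ∀ k, 0 ≤ w k)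
    (h : ∀ i j, HasSum (fun k => w k * φ i k * φ j k) (A i j)) : A.PosSemidef := by
  refine Matrix.PosSemidef.of_dotProduct_mulVec_nonneg ?_ fun x => ?_
  · ext i j
    refine (h j i).unique ?_
    simpa only [mul_right_comm] using h i j
  · have hsum : HasSum (fun k => ∑ i, ∑ j, x i * (w k * φ i k * φ j k * x j))
        (∑ i, ∑ j, x i * (A i j * x j)) :=
      hasSum_sum fun i _ => hasSum_sum fun j _ => ((h i j).mul_right (x j)).mul_left (x i)
    have heq : star x ⬝ᵥ A.mulVec x = ∑ i, ∑ j, x i * (A i j * x j) := by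
      simp [dotProduct, Matrix.mulVec, Finset.mul_sum]
    rw [heq]
    refine hsum.nonneg fun k => ?_
    have hsq : ∑ i, ∑ j, x i * (w k * φ i k * φ j k * x j) = w k * (∑ i, x i * φ i k) ^ 2 := by
      rw [sq, Finset.sum_mul_sum, Finset.mul_sum]
      refine Finset.sum_congr rfl fun i _ => ?_
      rw [Finset.mul_sum]
      exact Finset.sum_congr rfl fun j _ => by ring
    rw [hsq]
    exact mul_nonneg (hw k) (sq_nonneg _)

/-- The feature `k ↦ 1 - α ^ (k - i + 1)`, truncated to `k ≥ i`, of the DC2 kernel. -/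
noncomputable def dc2Feature (α : ℝ) (i k : ℕ) : ℝ :=
  if i ≤ k then 1 - α ^ (k - i + 1) else 0

theorem hasSum_dc2Feature_mul_dc2Feature_add {α β : ℝ} (hα : α ∈ Set.Ioo (0 : ℝ) 1)
    (hβ : β ∈ Set.Ioo (0 : ℝ) 1) (i d : ℕ) :
    HasSum (fun k => (1 - β) * (1 - α * β) * (1 - α ^ 2 * β) / (1 - α) * β ^ (k + 1) *
        dc2Feature α i k * dc2Feature α (i + d) k)
      (β ^ (i + d + 1) * (1 - (1 - β) * α ^ (d + 1)) - α ^ 2 * β ^ (i + d + 1 + 1)) := by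
  obtain ⟨hα0, hα1⟩ := hα
  obtain ⟨hβ0, hβ1⟩ := hβ
  have hαβ : α * β < 1 := by nlinarith
  have hααβ : α ^ 2 * β < 1 := by nlinarith [mul_pos hα0 hβ0]
  have h1 := hasSum_geometric_of_lt_one hβ0.le hβ1
  have h2 := hasSum_geometric_of_lt_one (mul_pos hα0 hβ0).le hαβ
  have h3 := hasSum_geometric_of_lt_one (mul_pos (pow_pos hα0 2) hβ0).le hααβ
  have hne1 : 1 - α ≠ 0 := by linarith
  have hne2 : 1 - β ≠ 0 := by linarith
  have hne3 : 1 - α * β ≠ 0 := by linarith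
  have hne4 : 1 - α ^ 2 * β ≠ 0 := by linarith
  rw [← hasSum_nat_add_iff' (i + d), Finset.sum_eq_zero, sub_zero]
  · have h := ((h1.sub (h2.mul_left (α + α ^ (d + 1)))).add (h3.mul_left (α ^ (d + 2)))).mul_left
      ((1 - β) * (1 - α * β) * (1 - α ^ 2 * β) / (1 - α) * β ^ (i + d + 1))
    convert h using 1
    · rfl
    · funext n
      have e1 : dc2Feature α i (n + (i + d)) = 1 - α ^ (n + d + 1) := by
        rw [dc2Feature, if_pos (by omega)]
        congr 2
        omega
      have e2 : dc2Feature α (i + d) (n + (i + d)) = 1 - α ^ (n + 1) := by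
        rw [dc2Feature, if_pos (by omega)]
        congr 2
        omega
      rw [e1, e2]
      ring
    · generalize hu : 1 - α * β = u at *
      generalize hv : 1 - α ^ 2 * β = v at *
      field_simp
      rw [← hu, ← hv]
      ring
  · intro k hk
    have hk' : ¬ i + d ≤ k := by simpa using hk
    simp [dc2Feature, hk']


/-- For `α, β ∈ (0,1)` and `T ≥ 1`, the DC2 kernel matrix with entries
`K i j = β^max(i,j) (1 - (1-β) α^(|i-j|+1)) - α² β^(max(i,j)+1)` for `i, j ∈ {1,…,T}`
(here index `i : Fin T` stands for `i+1`) is symmetric positive semidefinite. -/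
theorem dc2_kernel_posSemidef (T : ℕ) (hT : 1 ≤ T) (α β : ℝ)
    (hα : α ∈ Set.Ioo (0 : ℝ) 1) (hβ : β ∈ Set.Ioo (0 : ℝ) 1) :
    (Matrix.of fun i j : Fin T =>
      β ^ (max (i.1 + 1) (j.1 + 1)) *
          (1 - (1 - β) * α ^ (((i.1 : ℤ) - (j.1 : ℤ)).natAbs + 1)) -
        α ^ 2 * β ^ (max (i.1 + 1) (j.1 + 1) + 1)).PosSemidef := by
  have hw : ∀ k : ℕ,
      0 ≤ (1 - β) * (1 - α * β) * (1 - α ^ 2 * β) / (1 - α) * β ^ (k + 1) := by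
    obtain ⟨hα0, hα1⟩ := hα
    obtain ⟨hβ0, hβ1⟩ := hβ
    have h1 : 0 < 1 - α := by linarith
    have h2 : 0 < 1 - β := by linarith
    have h3 : 0 < 1 - α * β := by nlinarith
    have h4 : 0 < 1 - α ^ 2 * β := by nlinarith [mul_pos hα0 hβ0]
    intro k
    positivity
  refine Matrix.posSemidef_of_hasSum_mul (φ := fun i k => dc2Feature α i.1 k) hw fun i j => ?_
  rw [Matrix.of_apply]
  rcases le_total i.1 j.1 with hij | hij
  · obtain ⟨d, hd⟩ := Nat.exists_eq_add_of_le hij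
    have h := hasSum_dc2Feature_mul_dc2Feature_add hα hβ i.1 d
    have hm : max (i.1 + 1) (j.1 + 1) = i.1 + d + 1 := by omega
    have ha : ((i.1 : ℤ) - (j.1 : ℤ)).natAbs = d := by omega
    rw [hm, ha, hd]
    exact h
  · obtain ⟨d, hd⟩ := Nat.exists_eq_add_of_le hij
    have h := hasSum_dc2Feature_mul_dc2Feature_add hα hβ j.1 d
    have hm : max (i.1 + 1) (j.1 + 1) = j.1 + d + 1 := by omega
    have ha : ((i.1 : ℤ) - (j.1 : ℤ)).natAbs = d := by omega
    simp only [mul_right_comm _ (dc2Feature α i.1 _)]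
    rw [hm, ha, hd]
    exact h
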